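/- arXiv:1812.04285 — 3 statements merged into one kernel-verified Lean document; each statement's English description precedes it below -/
import Mathlib

section
/- Let 𝔛 be a compact metric space and let Θ = (θ_k)_k ∈ 𝔊^≺_𝔛. Then limsup_k sup_{μ∈𝔛} θ_k(μ) = sup_{μ∈𝔛} limsup_k θ̃_k(μ), where θ̃_k denotes the upper semicontinuous envelope of θ_k. -/
open Filter Topology

namespace EntropyStructure

variable {𝔛 : Type*} [MetricSpace 𝔛]

/-- A sequence of functions belongs to `𝔉_𝔛` when it is uniformly bounded. -/
def BddSeq (h : ℕ → 𝔛 → ℝ) : Prop := ∃ C : ℝ, ∀ k x, |h k x| ≤ C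

/-- `𝒢 ≻ ℋ` : `𝒢` uniformly dominates `ℋ`, i.e.
`limsup_k limsup_l sup_μ (h_k − g_l)(μ) ≤ 0`. -/
def Dominates (g h : ℕ → 𝔛 → ℝ) : Prop :=
  Filter.atTop.limsup (fun k => Filter.atTop.limsup fun l => ⨆ x, (h k x - g l x)) ≤ 0

/-- `Γ ≺ Θ` : `Γ` uniformly yields `Θ`, i.e.
`limsup_k limsup_l sup_μ (γ_l − θ_k)(μ) ≤ 0`. -/
def Yields (γ θ : ℕ → 𝔛 → ℝ) : Prop :=
  Filter.atTop.limsup (fun k => Filter.atTop.limsup fun l => ⨆ x, (γ l x - θ k x)) ≤ 0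

/-- The upper semicontinuous envelope of a function: the pointwise infimum of all upper
semicontinuous functions above it. -/
noncomputable def uscEnv (f : 𝔛 → ℝ) : 𝔛 → ℝ := fun x =>
  ⨅ g : {g : 𝔛 → ℝ // UpperSemicontinuous g ∧ ∀ z, f z ≤ g z}, (g : 𝔛 → ℝ) x

theorem bddBelow_usc_majorants {f : 𝔛 → ℝ} (x : 𝔛) :
    BddBelow (Set.range fun g : {g : 𝔛 → ℝ // UpperSemicontinuous g ∧ ∀ z, f z ≤ g z} =>
      (g : 𝔛 → ℝ) x) :=
  ⟨f x, by rintro _ ⟨g, rfl⟩; exact g.2.2 x⟩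

theorem uscEnv_le_of_forall_le {f : 𝔛 → ℝ} {c : ℝ} (h : ∀ z, f z ≤ c) (x : 𝔛) :
    uscEnv f x ≤ c :=
  ciInf_le (bddBelow_usc_majorants x) ⟨fun _ => c, upperSemicontinuous_const, h⟩

/-- The envelope of a function bounded above is at least `c` at every point near which the
function is frequently at least `c`. -/
theorem le_uscEnv_of_frequently {f : 𝔛 → ℝ} {C c : ℝ} (hC : ∀ z, f z ≤ C) {x : 𝔛}
    (h : ∃ᶠ z in 𝓝 x, c ≤ f z) : c ≤ uscEnv f x := by
  have : Nonempty {g : 𝔛 → ℝ // UpperSemicontinuous g ∧ ∀ z, f z ≤ g z} :=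
    ⟨⟨fun _ => C, upperSemicontinuous_const, hC⟩⟩
  refine le_ciInf fun g => ?_
  by_contra! hlt
  obtain ⟨z, hcz, hz⟩ := (h.and_eventually (g.2.1 x c hlt)).exists
  exact absurd (hcz.trans (g.2.2 z)) (not_le.mpr hz)

theorem isBoundedUnder_le_of_abs_le {u : ℕ → ℝ} {C : ℝ} (h : ∀ k, |u k| ≤ C) :
    atTop.IsBoundedUnder (· ≤ ·) u :=
  isBoundedUnder_of ⟨C, fun k => (abs_le.mp (h k)).2⟩

theorem isCoboundedUnder_le_of_abs_le {u : ℕ → ℝ} {C : ℝ} (h : ∀ k, |u k| ≤ C) :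
    atTop.IsCoboundedUnder (· ≤ ·) u :=
  (isBoundedUnder_of (r := (· ≥ ·)) ⟨-C, fun k => (abs_le.mp (h k)).1⟩).isCoboundedUnder_le

theorem abs_limsup_le_of_abs_le {u : ℕ → ℝ} {C : ℝ} (h : ∀ k, |u k| ≤ C) :
    |atTop.limsup u| ≤ C :=
  abs_le.mpr
    ⟨le_limsup_of_frequently_le (Frequently.of_forall fun k => (abs_le.mp (h k)).1)
      (isBoundedUnder_le_of_abs_le h),
    limsup_le_of_le (isCoboundedUnder_le_of_abs_le h)
      (Eventually.of_forall fun k => (abs_le.mp (h k)).2)⟩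

theorem abs_iSup_le_of_abs_le {ι : Type*} [Nonempty ι] {u : ι → ℝ} {C : ℝ}
    (h : ∀ i, |u i| ≤ C) : |⨆ i, u i| ≤ C := by
  obtain ⟨i⟩ := ‹Nonempty ι›
  exact abs_le.mpr
    ⟨(abs_le.mp (h i)).1.trans
      (le_ciSup ⟨C, by rintro _ ⟨j, rfl⟩; exact (abs_le.mp (h j)).2⟩ i),
    ciSup_le fun j => (abs_le.mp (h j)).2⟩

theorem abs_uscEnv_le {f : 𝔛 → ℝ} {C : ℝ} (h : ∀ z, |f z| ≤ C) (x : 𝔛) :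
    |uscEnv f x| ≤ C := by
  refine abs_le.mpr ⟨?_, uscEnv_le_of_forall_le (fun z => (abs_le.mp (h z)).2) x⟩
  exact le_uscEnv_of_frequently (fun z => (abs_le.mp (h z)).2)
    (Frequently.of_forall fun z => (abs_le.mp (h z)).1)

theorem Yields.eventually_le_add {X : Type*} [Nonempty X] {γ θ : ℕ → X → ℝ} (hγ : BddSeq γ)
    (hθ : BddSeq θ) (h : Yields γ θ) {ε : ℝ} (hε : 0 < ε) :
    ∀ᶠ k in atTop, ∀ᶠ l in atTop, ∀ x, γ l x ≤ θ k x + ε := by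
  obtain ⟨A, hA⟩ := hγ
  obtain ⟨B, hB⟩ := hθ
  have hd : ∀ k l x, |γ l x - θ k x| ≤ A + B := fun k l x =>
    (abs_sub _ _).trans (add_le_add (hA l x) (hB k x))
  have hs : ∀ k l, |⨆ x, (γ l x - θ k x)| ≤ A + B := fun k l => abs_iSup_le_of_abs_le (hd k l)
  have hk := eventually_lt_of_limsup_lt (h.trans_lt hε)
    (isBoundedUnder_le_of_abs_le fun k => abs_limsup_le_of_abs_le (hs k))
  filter_upwards [hk] with k hk
  filter_upwards [eventually_lt_of_limsup_lt hk (isBoundedUnder_le_of_abs_le (hs k))] with l hl x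
  have := le_ciSup (f := fun x => γ l x - θ k x)
    ⟨A + B, by rintro _ ⟨y, rfl⟩; exact (abs_le.mp (hd k l y)).2⟩ x
  linarith

/-- for `Θ ∈ 𝔊^≺_𝔛`,
`limsup_k sup_μ θ_k(μ) = sup_μ limsup_k θ̃_k(μ)`. -/
theorem limsup_sup_eq_sup_limsup_uscEnv {𝔛 : Type*} [MetricSpace 𝔛] [CompactSpace 𝔛]
    (θ : ℕ → 𝔛 → ℝ) (hb : BddSeq θ) (hy : Yields θ θ) :
    Filter.atTop.limsup (fun k => ⨆ μ, θ k μ) =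
      ⨆ μ, Filter.atTop.limsup fun k => uscEnv (θ k) μ := by
  rcases isEmpty_or_nonempty 𝔛 with h | h
  · simp [Real.iSup_of_isEmpty]
  have hb' := hb
  obtain ⟨C, hC⟩ := hb
  have hC' : ∀ k z, θ k z ≤ C := fun k z => (abs_le.mp (hC k z)).2
  have hsup : ∀ k, |⨆ μ, θ k μ| ≤ C := fun k => abs_iSup_le_of_abs_le (hC k)
  have henv : ∀ x k, |uscEnv (θ k) x| ≤ C := fun x k => abs_uscEnv_le (hC k) x
  apply le_antisymm
  · refine le_of_forall_pos_le_add fun ε hε => ?_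
    set S := atTop.limsup fun k => ⨆ μ, θ k μ
    have hfreq : ∃ᶠ l in atTop, ∃ x, S - ε / 2 < θ l x := by
      refine (frequently_lt_of_lt_limsup (isCoboundedUnder_le_of_abs_le hsup)
        (show S - ε / 2 < S by linarith)).mono fun l hl => exists_lt_of_lt_ciSup hl
    have : NeBot (atTop ⊓ 𝓟 {l | ∃ x, S - ε / 2 < θ l x}) :=
      frequently_mem_iff_neBot.mp hfreq
    have hchoose : ∀ l, ∃ x, (∃ y, S - ε / 2 < θ l y) → S - ε / 2 < θ l x := fun l => by
      by_cases hl : ∃ y, S - ε / 2 < θ l y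
      · exact hl.imp fun _ hx _ => hx
      · exact ⟨Classical.arbitrary 𝔛, fun h => absurd h hl⟩
    choose p hp using hchoose
    obtain ⟨x, hx⟩ := exists_clusterPt_of_compactSpace
      (map p (atTop ⊓ 𝓟 {l | ∃ x, S - ε / 2 < θ l x}))
    have hk : ∀ᶠ k in atTop, S - ε ≤ uscEnv (θ k) x := by
      filter_upwards [hy.eventually_le_add hb' hb' (half_pos hε)] with k hk
      refine le_uscEnv_of_frequently (hC' k) (hx.frequently' ?_)
      rw [eventually_map, eventually_inf_principal]
      filter_upwards [hk] with l hl hmem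
      linarith [hl (p l), hp l hmem]
    have hM : S - ε ≤ atTop.limsup fun k => uscEnv (θ k) x :=
      le_limsup_of_frequently_le hk.frequently (isBoundedUnder_le_of_abs_le (henv x))
    have := le_ciSup (f := fun μ => atTop.limsup fun k => uscEnv (θ k) μ)
      ⟨C, by rintro _ ⟨y, rfl⟩; exact (abs_le.mp (abs_limsup_le_of_abs_le (henv y))).2⟩ x
    linarith
  · refine ciSup_le fun x => ?_
    refine limsup_le_limsup (Eventually.of_forall fun k => ?_)
      (isCoboundedUnder_le_of_abs_le (henv x)) (isBoundedUnder_le_of_abs_le hsup)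
    exact uscEnv_le_of_forall_le
      (le_ciSup ⟨C, by rintro _ ⟨y, rfl⟩; exact hC' k y⟩) x

end EntropyStructure
end

section
/- Let 𝔛 be a compact metric space, let ℋ = (h_k)_k ∈ 𝔉_𝔛 and let 𝒢 = (g_l)_l ∈ 𝔊^≻_𝔛. If for every k ∈ ℕ and every μ ∈ 𝔛 one has limsup_l (h_k − g_l)~(μ) ≤ 0, where (h_k − g_l)~ denotes the upper semicontinuous envelope of h_k − g_l, then 𝒢 uniformly dominates ℋ, i.e. 𝒢 ≻ ℋ. -/
open Filter Topology

namespace EntropyStructure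

variable {𝔛 : Type*} [MetricSpace 𝔛]

theorem abs_iSup_le {ι : Sort*} {f : ι → ℝ} {C : ℝ} (hC : 0 ≤ C) (hf : ∀ i, |f i| ≤ C) :
    |⨆ i, f i| ≤ C := by
  rcases isEmpty_or_nonempty ι with _ | ⟨⟨i⟩⟩
  · simpa using hC
  · have hbdd : BddAbove (Set.range f) := ⟨C, by rintro _ ⟨j, rfl⟩; exact (abs_le.1 (hf j)).2⟩
    exact abs_le.2 ⟨(abs_le.1 (hf i)).1.trans (le_ciSup hbdd i),
      Real.iSup_le (fun j => (abs_le.1 (hf j)).2) hC⟩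

theorem isBoundedUnder_le_of_abs_le_s18 {u : ℕ → ℝ} {C : ℝ} (hu : ∀ n, |u n| ≤ C) :
    IsBoundedUnder (· ≤ ·) atTop u :=
  isBoundedUnder_of ⟨C, fun n => (abs_le.1 (hu n)).2⟩

theorem isCoboundedUnder_le_of_abs_le_s18 {u : ℕ → ℝ} {C : ℝ} (hu : ∀ n, |u n| ≤ C) :
    IsCoboundedUnder (· ≤ ·) atTop u :=
  (isBoundedUnder_of ⟨-C, fun n => (abs_le.1 (hu n)).1⟩ :
    IsBoundedUnder (· ≥ ·) atTop u).isCoboundedUnder_le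

theorem abs_limsup_le {u : ℕ → ℝ} {C : ℝ} (hu : ∀ n, |u n| ≤ C) :
    |atTop.limsup u| ≤ C :=
  abs_le.2 ⟨le_limsup_of_frequently_le (Frequently.of_forall fun n => (abs_le.1 (hu n)).1)
      (isBoundedUnder_le_of_abs_le_s18 hu),
    limsup_le_of_le (isCoboundedUnder_le_of_abs_le_s18 hu)
      (Eventually.of_forall fun n => (abs_le.1 (hu n)).2)⟩

/-- Differences of terms of two uniformly bounded sequences are uniformly bounded. -/
theorem BddSeq.exists_abs_sub_le {α : Type*} {h g : ℕ → α → ℝ} (hh : BddSeq h) (hg : BddSeq g) :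
    ∃ C : ℝ, 0 ≤ C ∧ ∀ k l x, |h k x - g l x| ≤ C := by
  obtain ⟨A, hA⟩ := hh
  obtain ⟨B, hB⟩ := hg
  refine ⟨|A| + |B|, by positivity, fun k l x => (abs_sub _ _).trans ?_⟩
  exact add_le_add ((hA k x).trans (le_abs_self A)) ((hB l x).trans (le_abs_self B))

theorem Dominates.eventually_eventually_sub_lt {α : Type*} {h g : ℕ → α → ℝ} (hd : Dominates g h)
    (hh : BddSeq h) (hg : BddSeq g) {ε : ℝ} (hε : 0 < ε) :
    ∀ᶠ k in atTop, ∀ᶠ l in atTop, ∀ x, h k x - g l x < ε := by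
  obtain ⟨C, hC, hC'⟩ := hh.exists_abs_sub_le hg
  have hsup : ∀ k l, |⨆ x, (h k x - g l x)| ≤ C := fun k l => abs_iSup_le hC (hC' k l)
  have houter := eventually_lt_of_limsup_lt (lt_of_le_of_lt hd hε)
    (isBoundedUnder_le_of_abs_le_s18 fun k => abs_limsup_le (hsup k))
  filter_upwards [houter] with k hk
  filter_upwards [eventually_lt_of_limsup_lt hk (isBoundedUnder_le_of_abs_le_s18 (hsup k))]
    with l hl x
  have hbdd : BddAbove (Set.range fun x => h k x - g l x) :=
    ⟨C, by rintro _ ⟨y, rfl⟩; exact (abs_le.1 (hC' k l y)).2⟩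
  exact (le_ciSup hbdd x).trans_lt hl

theorem dominates_of_forall_eventually_sub_le {α : Type*} {h g : ℕ → α → ℝ}
    (hh : BddSeq h) (hg : BddSeq g)
    (hle : ∀ k, ∀ ε > 0, ∀ᶠ l in atTop, ∀ x, h k x - g l x ≤ ε) : Dominates g h := by
  obtain ⟨C, hC, hC'⟩ := hh.exists_abs_sub_le hg
  have hsup : ∀ k l, |⨆ x, (h k x - g l x)| ≤ C := fun k l => abs_iSup_le hC (hC' k l)
  refine limsup_le_of_le (isCoboundedUnder_le_of_abs_le_s18 fun k => abs_limsup_le (hsup k))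
    (Eventually.of_forall fun k => le_of_forall_pos_le_add fun ε hε => ?_)
  rw [zero_add]
  exact limsup_le_of_le (isCoboundedUnder_le_of_abs_le_s18 (hsup k))
    ((hle k ε hε).mono fun l hl => Real.iSup_le hl hε.le)

theorem uscEnv_le_of_forall_le_s18 {f : 𝔛 → ℝ} {C : ℝ} (hf : ∀ x, f x ≤ C) (x : 𝔛) :
    uscEnv f x ≤ C :=
  ciInf_le (f := fun u : {u : 𝔛 → ℝ // UpperSemicontinuous u ∧ ∀ z, f z ≤ u z} => u.1 x)
    ⟨f x, by rintro _ ⟨u, rfl⟩; exact u.2.2 x⟩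
    ⟨fun _ => C, upperSemicontinuous_const, hf⟩

theorem eventually_lt_of_uscEnv_lt {f : 𝔛 → ℝ} {C c : ℝ} (hf : ∀ x, f x ≤ C) {x : 𝔛}
    (hx : uscEnv f x < c) : ∀ᶠ y in 𝓝 x, f y < c := by
  have : Nonempty {u : 𝔛 → ℝ // UpperSemicontinuous u ∧ ∀ z, f z ≤ u z} :=
    ⟨⟨fun _ => C, upperSemicontinuous_const, hf⟩⟩
  obtain ⟨u, hu⟩ := exists_lt_of_ciInf_lt hx
  exact (u.2.1 x c hu).mono fun y hy => (u.2.2 y).trans_lt hy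

/-- if `limsup_l (h_k − g_l)~ ≤ 0` pointwise for all `k`, with `𝒢 ∈ 𝔊^≻_𝔛`,
then `𝒢` uniformly dominates `ℋ`. -/
theorem dominates_of_limsup_uscEnv_le {𝔛 : Type*} [MetricSpace 𝔛] [CompactSpace 𝔛]
    (h g : ℕ → 𝔛 → ℝ) (hh : BddSeq h) (hg : BddSeq g) (hgg : Dominates g g)
    (hyp : ∀ k : ℕ, ∀ μ : 𝔛,
      Filter.atTop.limsup (fun l => uscEnv (fun ν => h k ν - g l ν) μ) ≤ 0) :
    Dominates g h := by
  refine dominates_of_forall_eventually_sub_le hh hg fun k ε hε => ?_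
  obtain ⟨C, -, hC⟩ := hh.exists_abs_sub_le hg
  have hle : ∀ l x, h k x - g l x ≤ C := fun l x => (abs_le.1 (hC k l x)).2
  have hlocal : ∀ μ : 𝔛, ∃ U ∈ 𝓝 μ, ∀ᶠ l in atTop, ∀ x ∈ U, h k x - g l x ≤ ε := by
    intro μ
    have henv := eventually_lt_of_limsup_lt ((hyp k μ).trans_lt (half_pos hε))
      (isBoundedUnder_of ⟨C, fun l => uscEnv_le_of_forall_le_s18 (hle l) μ⟩)
    obtain ⟨p, hp, hpg⟩ :=
      (henv.and (hgg.eventually_eventually_sub_lt hg hg (half_pos hε))).exists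
    refine ⟨_, eventually_lt_of_uscEnv_lt (hle p) hp, ?_⟩
    filter_upwards [hpg] with l hl x hx
    have hx' : h k x - g p x < ε / 2 := hx
    linarith [hl x]
  choose U hU hUl using hlocal
  obtain ⟨t, ht⟩ := CompactSpace.elim_nhds_subcover U hU
  filter_upwards [(Filter.eventually_all_finset t).2 fun μ _ => hUl μ] with l hl x
  have hx : x ∈ ⋃ μ ∈ t, U μ := ht ▸ Set.mem_univ x
  obtain ⟨μ, hμ, hxμ⟩ := Set.mem_iUnion₂.1 hx
  exact hl μ hμ x hxμ

end EntropyStructure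
end

section
/- Let (X,T) be a topological dynamical system given by a homeomorphism T of a compact metric space X, let A be a finite alphabet, let (Y,σ) be a subshift of A^ℤ, and let π : (Y,σ) → (X,T) be a strongly isomorphic symbolic extension admitting a Borel equivariant map ψ : X → Y with π ∘ ψ = Id_X. Then the partition ψ^{-1}Q of X, where Q is the zero-coordinate partition of Y, is an essential uniform generator of (X,T); in particular, for every a ∈ A the topological boundary of ψ^{-1}({y ∈ Y : y_0 = a}) is contained in the set of points of X having at least two π-preimages, and hence has zero measure for every T-invariant Borel probability measure. -/
open Set Filter Topology MeasureTheory

/-- The shift map on bi-infinite sequences. -/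
def shiftMap {A : Type*} : (ℤ → A) → (ℤ → A) := fun u n => u (n + 1)

/-- Words of a compact set that agree on a long central window have close images under a
continuous map. -/
theorem exists_window_dist_le {X A : Type*} [MetricSpace X] [TopologicalSpace A]
    [DiscreteTopology A] {Y : Set (ℤ → A)} (hY : IsCompact Y) {π : (ℤ → A) → X}
    (hπ : ContinuousOn π Y) {ε : ℝ} (hε : 0 < ε) :
    ∃ N : ℕ, ∀ u ∈ Y, ∀ v ∈ Y, (∀ k : ℤ, |k| ≤ (N : ℤ) → u k = v k) → dist (π u) (π v) ≤ ε := by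
  have hdist : ContinuousOn (fun p : (ℤ → A) × (ℤ → A) => dist (π p.1) (π p.2)) (Y ×ˢ Y) :=
    continuous_dist.comp_continuousOn ((hπ.comp continuousOn_fst fun _ hp => hp.1).prodMk
      (hπ.comp continuousOn_snd fun _ hp => hp.2))
  have hcompact : IsCompact ((Y ×ˢ Y) ∩
      (fun p : (ℤ → A) × (ℤ → A) => dist (π p.1) (π p.2)) ⁻¹' Ici ε) := by
    have hYY := hY.prod hY
    exact hYY.of_isClosed_subset
      (hdist.preimage_isClosed_of_isClosed hYY.isClosed isClosed_Ici) inter_subset_left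
  obtain ⟨N, hN⟩ := hcompact.elim_directed_family_closed
    (fun n : ℕ => {p : (ℤ → A) × (ℤ → A) | ∀ k : ℤ, |k| ≤ (n : ℤ) → p.1 k = p.2 k})
    (fun n => by
      simp only [Set.ofPred_forall]
      exact isClosed_iInter fun k => isClosed_iInter fun _ =>
        isClosed_eq (by fun_prop) (by fun_prop))
    (by
      refine eq_empty_of_forall_notMem ?_
      rintro ⟨u, v⟩ ⟨⟨_, hge⟩, hmem⟩
      have huv : u = v := funext fun k =>
        mem_iInter.1 hmem k.natAbs k (Int.abs_eq_natAbs k).le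
      subst huv
      have : ε ≤ dist (π u) (π u) := hge
      rw [dist_self] at this
      exact absurd this (not_le.2 hε))
    (directed_of_isDirected_le fun m n hmn p hp k hk =>
      hp k (hk.trans (by exact_mod_cast hmn)))
  refine ⟨N, fun u hu v hv huv => le_of_not_ge fun hge => ?_⟩
  have : (u, v) ∈ (∅ : Set ((ℤ → A) × (ℤ → A))) := hN ▸ ⟨⟨⟨hu, hv⟩, hge⟩, huv⟩
  exact this

/-- A map equivariant for the shift reads off coordinates along orbits. -/
theorem equivariant_zpow_apply {X A : Type*} (T : Equiv.Perm X) {ψ : X → ℤ → A}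
    (hψ : ∀ x, ψ (T x) = shiftMap (ψ x)) (k : ℤ) :
    ∀ (x : X) (n : ℤ), ψ ((T ^ k) x) n = ψ x (n + k) := by
  induction k using Int.induction_on with
  | zero => simp
  | succ k ih =>
    intro x n
    rw [zpow_add_one, Equiv.Perm.mul_apply, ih, hψ, shiftMap]
    congr 1
    ring
  | pred k ih =>
    intro x n
    have h := hψ (T⁻¹ x)
    rw [← Equiv.Perm.mul_apply, mul_inv_cancel, Equiv.Perm.one_apply] at h
    rw [zpow_sub_one, Equiv.Perm.mul_apply, ih, h, shiftMap]
    congr 1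
    ring

/-- The frontier of an atom pulled back by a section of `π` consists of points with at least two
preimages. -/
theorem frontier_preimage_section_subset {X A : Type*} [TopologicalSpace X] [T2Space X]
    [TopologicalSpace A] [DiscreteTopology A] {Y : Set (ℤ → A)} (hY : IsCompact Y)
    {π : (ℤ → A) → X} (hπ : ContinuousOn π Y) {ψ : X → ℤ → A} (hψY : ∀ x, ψ x ∈ Y)
    (hπψ : ∀ x, π (ψ x) = x) (a : A) :
    frontier (ψ ⁻¹' {u : ℤ → A | u 0 = a}) ⊆
      {x : X | ∃ u ∈ Y, ∃ v ∈ Y, u ≠ v ∧ π u = x ∧ π v = x} := by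
  have key : ∀ s : Set A, closure (ψ ⁻¹' {u | u 0 ∈ s}) ⊆ π '' (Y ∩ {u | u 0 ∈ s}) := by
    intro s
    have hs : IsClosed {u : ℤ → A | u 0 ∈ s} :=
      (isClosed_discrete s).preimage (continuous_apply 0)
    refine closure_minimal (fun x hx => ⟨ψ x, ⟨hψY x, hx⟩, hπψ x⟩) ?_
    exact ((hY.inter_right hs).image_of_continuousOn (hπ.mono inter_subset_left)).isClosed
  intro x hx
  rw [frontier_eq_closure_inter_closure] at hx
  obtain ⟨u, ⟨huY, hu⟩, hux⟩ := key {a} hx.1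
  obtain ⟨v, ⟨hvY, hv⟩, hvx⟩ := key {a}ᶜ hx.2
  refine ⟨u, huY, v, hvY, ?_, hux, hvx⟩
  rintro rfl
  exact hv hu

/-- a strongly isomorphic symbolic extension `π : (Y,σ) → (X,T)` with a Borel
equivariant embedding `ψ` (a section of `π`) yields an essential uniform generator: the
partition `ψ⁻¹Q` given by the zero-coordinate partition `Q` of `Y` is a uniform generator, the
frontier of each of its atoms consists of points with at least two `π`-preimages, and hence is
null for every `T`-invariant Borel probability measure. -/
theorem essential_uniform_generator_of_strongly_isomorphic
    {X : Type*} [MetricSpace X] [CompactSpace X] [MeasurableSpace X] [BorelSpace X]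
    {A : Type*} [Fintype A] [TopologicalSpace A] [DiscreteTopology A]
    [MeasurableSpace A] [BorelSpace A]
    (T : X ≃ₜ X) (Y : Set (ℤ → A)) (hYclosed : IsClosed Y)
    (hYinv : shiftMap '' Y = Y)
    (π : (ℤ → A) → X) (hπcont : ContinuousOn π Y) (hπsurj : π '' Y = univ)
    (hπequiv : ∀ u ∈ Y, π (shiftMap u) = T (π u))
    -- strong isomorphism : `π` is injective over a full set `E`
    (E : Set X) (hEmeas : MeasurableSet E)
    (hEfull : ∀ μ : Measure X, IsProbabilityMeasure μ → Measure.map T μ = μ → μ Eᶜ = 0)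
    (hEinj : Set.InjOn π (Y ∩ π ⁻¹' E))
    -- the Borel embedding `ψ`
    (ψ : X → ℤ → A) (hψmeas : Measurable ψ) (hψY : ∀ x, ψ x ∈ Y)
    (hψequiv : ∀ x, ψ (T x) = shiftMap (ψ x))
    (hπψ : ∀ x, π (ψ x) = x) :
    -- `ψ⁻¹Q` is a uniform generator :
    (∀ ε > (0 : ℝ), ∃ N : ℕ, ∀ n ≥ N, ∀ x : X,
      Metric.diam {w : X | ∀ k : ℤ, |k| ≤ (n : ℤ) →
        ψ ((T.toEquiv ^ k) w) 0 = ψ ((T.toEquiv ^ k) x) 0} ≤ ε) ∧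
    -- the frontier of each atom lies in the set of points with two `π`-preimages :
    (∀ a : A, frontier (ψ ⁻¹' {u : ℤ → A | u 0 = a}) ⊆
      {x : X | ∃ u ∈ Y, ∃ v ∈ Y, u ≠ v ∧ π u = x ∧ π v = x}) ∧
    -- hence each atom has a null topological boundary, i.e. the generator is essential :
    (∀ a : A, ∀ μ : Measure X, IsProbabilityMeasure μ → Measure.map T μ = μ →
      μ (frontier (ψ ⁻¹' {u : ℤ → A | u 0 = a})) = 0) := by
  have hYc : IsCompact Y := hYclosed.isCompact
  have hfront := frontier_preimage_section_subset hYc hπcont hψY hπψ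
  refine ⟨fun ε hε => ?_, hfront, fun a μ hμ hinv => ?_⟩
  · obtain ⟨N, hN⟩ := exists_window_dist_le hYc hπcont hε
    refine ⟨N, fun n hn x => Metric.diam_le_of_forall_dist_le hε.le fun w hw z hz => ?_⟩
    rw [← hπψ w, ← hπψ z]
    refine hN _ (hψY w) _ (hψY z) fun k hk => ?_
    have hkn : |k| ≤ (n : ℤ) := hk.trans (by exact_mod_cast hn)
    have h := (hw k hkn).trans (hz k hkn).symm
    rwa [equivariant_zpow_apply T.toEquiv hψequiv, equivariant_zpow_apply T.toEquiv hψequiv,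
      zero_add] at h
  · refine measure_mono_null (t := Eᶜ) (fun x hx hxE => ?_) (hEfull μ hμ hinv)
    obtain ⟨u, huY, v, hvY, hne, rfl, hv⟩ := hfront a hx
    exact hne (hEinj ⟨huY, hxE⟩ ⟨hvY, by rwa [mem_preimage, hv]⟩ hv.symm)
end
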